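/- There exists a constant C > 0 such that for every sufficiently large n ∈ 16ℕ: ‖u_{0,n}‖_{B^1_{∞,1}(𝕋)} ≤ C n^{−2/5} log n. -/

import Mathlib

open MeasureTheory Filter Function
open scoped ENNReal NNReal

noncomputable section

/-- The Fourier coefficient `û(ξ) = ∫_{-π}^{π} e^{-i x ξ} u(x) dx` of a `2π`-periodic
function on the torus. -/
def fCoeff (u : ℝ → ℂ) (ξ : ℤ) : ℂ :=
  ∫ x in (-Real.pi)..Real.pi, Complex.exp (-Complex.I * x * ξ) * u x

/-- A Littlewood–Paley cutoff function: smooth, even, `0 ≤ χ ≤ 1`, `χ = 1` on `[-3/4,3/4]`,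
`supp χ ⊆ (-4/3, 4/3)`, nonincreasing on `[0,∞)`. -/
structure LPCutoff where
  χ : ℝ → ℝ
  smooth : ContDiff ℝ (⊤ : ℕ∞) χ
  even : ∀ x, χ (-x) = χ x
  nonneg : ∀ x, 0 ≤ χ x
  le_one : ∀ x, χ x ≤ 1
  eq_one : ∀ x ∈ Set.Icc (-(3/4) : ℝ) (3/4 : ℝ), χ x = 1
  supp : ∀ x, χ x ≠ 0 → x ∈ Set.Ioo (-(4/3) : ℝ) (4/3 : ℝ)
  decay : AntitoneOn χ (Set.Ici 0)

/-- `φ(ξ) = χ(ξ/2) - χ(ξ)`. -/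
def LPCutoff.phi (c : LPCutoff) (x : ℝ) : ℝ := c.χ (x / 2) - c.χ x

/-- The dyadic block `Δ_j u` (for `j ≥ -1`). -/
def LPblock (c : LPCutoff) (j : ℤ) (u : ℝ → ℂ) (x : ℝ) : ℂ :=
  if j = -1 then
    (1 / (2 * Real.pi)) * ∑' ξ : ℤ, (c.χ ξ : ℂ) * fCoeff u ξ * Complex.exp (Complex.I * x * ξ)
  else
    (1 / (2 * Real.pi)) *
      ∑' ξ : ℤ, (c.phi ((2:ℝ) ^ (-j) * ξ) : ℂ) * fCoeff u ξ * Complex.exp (Complex.I * x * ξ)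

/-- The low-frequency cut-off `S_j u`. -/
def LPlow (c : LPCutoff) (j : ℤ) (u : ℝ → ℂ) (x : ℝ) : ℂ :=
  (1 / (2 * Real.pi)) *
    ∑' ξ : ℤ, (c.χ ((2:ℝ) ^ (-j) * ξ) : ℂ) * fCoeff u ξ * Complex.exp (Complex.I * x * ξ)

/-- The `L^∞(𝕋)` (sup) norm, with values in `ℝ≥0∞`. -/
def supNormE {E : Type*} [NormedAddCommGroup E] (f : ℝ → E) : ℝ≥0∞ :=
  ⨆ x : ℝ, (‖f x‖₊ : ℝ≥0∞)

/-- View a real-valued function as a complex-valued one. -/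
def toC (f : ℝ → ℝ) : ℝ → ℂ := fun x => (f x : ℂ)

/-- The `2π`-periodic square wave: `1/2` on `(0,π)`, `-1/2` on `(-π,0)`, `0` on `{-π,0,π}`. -/
def hFun (x : ℝ) : ℝ :=
  let y := x - 2 * Real.pi * ⌊(x + Real.pi) / (2 * Real.pi)⌋
  if y = 0 ∨ y = -Real.pi then 0 else if 0 < y then 1/2 else -1/2

/-- The low-frequency part `f_n = S_{n/2} h` (real-valued). -/
def fLow (c : LPCutoff) (n : ℕ) : ℝ → ℝ := fun x => (LPlow c ((n : ℤ) / 2) (toC hFun) x).re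

/-- The initial data `u_{0,n}` for the periodic Camassa–Holm equation. -/
def u0CH (c : LPCutoff) (n : ℕ) : ℝ → ℝ := fun x =>
  (2:ℝ) ^ (-(n:ℤ)) * (n:ℝ) ^ (-(2:ℝ)/5) * Real.log n * Real.cos ((2:ℝ) ^ (n:ℕ) * x) *
    (1 + (n:ℝ) ^ (-(1:ℝ)/5) * fLow c n x)

/-- The `B^1_{∞,1}(𝕋)` norm `Σ_{j ≥ -1} 2^j ‖Δ_j u‖_{L^∞}`, with values in `ℝ≥0∞`. -/
def besov1E (c : LPCutoff) (u : ℝ → ℂ) : ℝ≥0∞ :=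
  ∑' k : ℕ, (2:ℝ≥0∞) ^ ((k:ℤ) - 1) * supNormE (LPblock c ((k:ℤ) - 1) u)


lemma hFun_pos {x : ℝ} (h0 : 0 < x) (h1 : x < Real.pi) : hFun x = 1/2 := by
  have hp := Real.pi_pos
  have hf : ⌊(x + Real.pi) / (2 * Real.pi)⌋ = 0 := by
    rw [Int.floor_eq_zero_iff]
    constructor
    · positivity
    · rw [div_lt_one (by positivity)]; linarith
  have h2 : ¬ (x = 0 ∨ x = -Real.pi) := by
    rintro (h | h) <;> linarith
  simp [hFun, hf, h2, h0]

lemma hFun_neg {x : ℝ} (h0 : -Real.pi < x) (h1 : x < 0) : hFun x = -1/2 := by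
  have hp := Real.pi_pos
  have hf : ⌊(x + Real.pi) / (2 * Real.pi)⌋ = 0 := by
    rw [Int.floor_eq_zero_iff]
    constructor
    · apply div_nonneg <;> linarith
    · rw [div_lt_one (by positivity)]; linarith
  have h2 : ¬ (x = 0 ∨ x = -Real.pi) := by
    rintro (h | h) <;> linarith
  simp [hFun, hf, h2, not_lt.2 h1.le]

lemma fCoeff_h_aux (k : ℤ) : fCoeff (toC hFun) k =
    (∫ x in (-Real.pi)..0, Complex.exp (-Complex.I * x * k) * (-1/2)) +
    ∫ x in (0:ℝ)..Real.pi, Complex.exp (-Complex.I * x * k) * (1/2) := by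
  have hp := Real.pi_pos
  have e1 : Set.EqOn (fun x : ℝ => Complex.exp (-Complex.I * x * k) * (-1/2))
      (fun x : ℝ => Complex.exp (-Complex.I * x * k) * toC hFun x) (Set.uIoo (-Real.pi) 0) := by
    intro x hx
    rw [Set.uIoo_of_le (by linarith)] at hx
    simp only [toC, hFun_neg hx.1 hx.2]
    push_cast; rfl
  have e2 : Set.EqOn (fun x : ℝ => Complex.exp (-Complex.I * x * k) * (1/2))
      (fun x : ℝ => Complex.exp (-Complex.I * x * k) * toC hFun x) (Set.uIoo 0 Real.pi) := by
    intro x hx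
    rw [Set.uIoo_of_le (by linarith)] at hx
    simp only [toC, hFun_pos hx.1 hx.2]
    push_cast; rfl
  have i1 : IntervalIntegrable (fun x : ℝ => Complex.exp (-Complex.I * x * k) * (-1/2)) volume
      (-Real.pi) 0 := by
    apply Continuous.intervalIntegrable; fun_prop
  have i2 : IntervalIntegrable (fun x : ℝ => Complex.exp (-Complex.I * x * k) * (1/2)) volume
      0 Real.pi := by
    apply Continuous.intervalIntegrable; fun_prop
  rw [intervalIntegral.integral_congr_uIoo e1, intervalIntegral.integral_congr_uIoo e2,
    intervalIntegral.integral_add_adjacent_intervals (i1.congr_uIoo e1) (i2.congr_uIoo e2)]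
  rfl

lemma exp_pi_int (k : ℤ) : Complex.exp (Complex.I * Real.pi * k) = (-1) ^ k := by
  rw [show Complex.I * Real.pi * k = k * (Real.pi * Complex.I) by ring, Complex.exp_int_mul,
    Complex.exp_pi_mul_I]

lemma exp_pi_int' (k : ℤ) : Complex.exp (-(Complex.I * Real.pi * k)) = (-1) ^ k := by
  have := exp_pi_int (-k)
  rw [show -(Complex.I * Real.pi * k) = Complex.I * Real.pi * ((-k : ℤ) : ℂ) by push_cast; ring,
    this, zpow_neg, ← inv_zpow]
  norm_num

lemma int_exp (k : ℤ) (hk : k ≠ 0) (a b : ℝ) : ∫ x in a..b, Complex.exp (-Complex.I * x * k) =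
    (Complex.exp (-Complex.I * k * b) - Complex.exp (-Complex.I * k * a)) / (-Complex.I * k) := by
  have hk' : (-Complex.I * k) ≠ 0 := by simp [hk]
  rw [← integral_exp_mul_complex hk']
  congr 1; ext x; congr 1; ring

lemma fCoeff_h_even (k : ℤ) (hk : Even k) : fCoeff (toC hFun) k = 0 := by
  rw [fCoeff_h_aux, intervalIntegral.integral_mul_const, intervalIntegral.integral_mul_const]
  by_cases h : k = 0
  · subst h; simp; ring
  · rw [int_exp k h, int_exp k h]
    have e1 : Complex.exp (-Complex.I * k * Real.pi) = 1 := by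
      rw [show -Complex.I * k * Real.pi = -(Complex.I * Real.pi * k) by ring, exp_pi_int',
        hk.neg_one_zpow]
    have e2 : Complex.exp (-Complex.I * k * (-Real.pi : ℝ)) = 1 := by
      rw [show -Complex.I * k * (-Real.pi : ℝ) = (Complex.I * Real.pi * k) by push_cast; ring,
        exp_pi_int, hk.neg_one_zpow]
    rw [e1, e2]; simp

lemma fCoeff_h_odd (k : ℤ) (hk : Odd k) : fCoeff (toC hFun) k = -2 * Complex.I / k := by
  have h : k ≠ 0 := by rintro rfl; simp at hk
  have hC : (k : ℂ) ≠ 0 := by exact_mod_cast h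
  rw [fCoeff_h_aux, intervalIntegral.integral_mul_const, intervalIntegral.integral_mul_const]
  rw [int_exp k h, int_exp k h]
  have e1 : Complex.exp (-Complex.I * k * Real.pi) = -1 := by
    rw [show -Complex.I * k * Real.pi = -(Complex.I * Real.pi * k) by ring, exp_pi_int',
      hk.neg_one_zpow]
  have e2 : Complex.exp (-Complex.I * k * (-Real.pi : ℝ)) = -1 := by
    rw [show -Complex.I * k * (-Real.pi : ℝ) = (Complex.I * Real.pi * k) by push_cast; ring,
      exp_pi_int, hk.neg_one_zpow]
  rw [e1, e2]
  have hI := Complex.I_ne_zero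
  simp only [Complex.ofReal_zero, mul_zero, Complex.exp_zero]
  field_simp
  simp only [Complex.I_sq]; ring

/-- multiplier relation -/
def MulRel (m : ℤ → ℂ) (u v : ℝ → ℂ) : Prop :=
  Continuous u ∧ ∀ x : ℝ, HasSum (fun ξ : ℤ => m ξ * fCoeff u ξ * Complex.exp (Complex.I * x * ξ))
    (2 * Real.pi * v x)

lemma fCoeff_exp (p ξ : ℤ) : fCoeff (fun x => Complex.exp (Complex.I * x * p)) ξ =
    if ξ = p then 2 * (Real.pi : ℂ) else 0 := by
  unfold fCoeff
  have : ∀ x : ℝ, Complex.exp (-Complex.I * x * ξ) * Complex.exp (Complex.I * x * p) =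
      Complex.exp (-Complex.I * x * ((ξ - p : ℤ) : ℂ)) := by
    intro x; rw [← Complex.exp_add]; congr 1; push_cast; ring
  simp only [this]
  split_ifs with h
  · subst h; simp; ring
  · rw [int_exp _ (sub_ne_zero.2 h),
      show -Complex.I * ((ξ - p : ℤ) : ℂ) * Real.pi = -(Complex.I * Real.pi * ((ξ - p : ℤ) : ℂ)) by ring,
      show -Complex.I * ((ξ - p : ℤ) : ℂ) * (-Real.pi : ℝ) = (Complex.I * Real.pi * ((ξ - p : ℤ) : ℂ)) by
        push_cast; ring, exp_pi_int, exp_pi_int']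
    simp

lemma MulRel.exp (m : ℤ → ℂ) (p : ℤ) : MulRel m (fun x => Complex.exp (Complex.I * x * p))
    (fun x => m p * Complex.exp (Complex.I * x * p)) := by
  refine ⟨by fun_prop, fun x => ?_⟩
  convert hasSum_single p ?_ using 1
  · rw [fCoeff_exp, if_pos rfl]; ring
  · intro q hq
    rw [fCoeff_exp, if_neg hq]; simp

lemma MulRel.add {m : ℤ → ℂ} {u v u' v' : ℝ → ℂ} (h : MulRel m u v) (h' : MulRel m u' v') :
    MulRel m (fun x => u x + u' x) (fun x => v x + v' x) := by
  have hu := h.1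
  have hu' := h'.1
  refine ⟨by fun_prop, fun x => ?_⟩
  convert (h.2 x).add (h'.2 x) using 1
  · ext ξ
    have : fCoeff (fun x => u x + u' x) ξ = fCoeff u ξ + fCoeff u' ξ := by
      unfold fCoeff
      rw [← intervalIntegral.integral_add]
      · congr 1; ext x; ring
      · apply Continuous.intervalIntegrable; fun_prop
      · apply Continuous.intervalIntegrable; fun_prop
    rw [this]; ring
  · ring

lemma MulRel.smul {m : ℤ → ℂ} {u v : ℝ → ℂ} (c : ℂ) (h : MulRel m u v) :
    MulRel m (fun x => c * u x) (fun x => c * v x) := by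
  have hu := h.1
  refine ⟨by fun_prop, fun x => ?_⟩
  have h2 := (h.2 x).mul_left c
  have e : (fun ξ : ℤ => m ξ * fCoeff (fun x => c * u x) ξ * Complex.exp (Complex.I * x * ξ)) =
      fun ξ : ℤ => c * (m ξ * fCoeff u ξ * Complex.exp (Complex.I * x * ξ)) := by
    ext ξ
    have : fCoeff (fun x => c * u x) ξ = c * fCoeff u ξ := by
      unfold fCoeff
      rw [← intervalIntegral.integral_const_mul]
      congr 1; ext x; ring
    rw [this]; ring
  rw [e, show 2 * Real.pi * (c * v x) = c * (2 * Real.pi * v x) by ring]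
  exact h2

lemma MulRel.sum {m : ℤ → ℂ} {u v : ℕ → ℝ → ℂ} (J : ℕ) (h : ∀ j, MulRel m (u j) (v j)) :
    MulRel m (fun x => ∑ j ∈ Finset.range J, u j x) (fun x => ∑ j ∈ Finset.range J, v j x) := by
  induction J with
  | zero =>
    refine ⟨by simp; fun_prop, fun x => ?_⟩
    simp [fCoeff, hasSum_zero]
  | succ J ih =>
    simp only [Finset.sum_range_succ]
    exact ih.add (h J)

lemma MulRel.cos {m : ℤ → ℂ} (hm : ∀ p, m (-p) = m p) (p : ℤ) :
    MulRel m (fun x => Complex.cos (p * x)) (fun x => m p * Complex.cos (p * x)) := by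
  convert ((MulRel.exp m p).add (MulRel.exp m (-p))).smul (1/2) using 1
  · ext x; rw [Complex.cos]; push_cast; ring_nf
  · ext x; rw [Complex.cos, hm]; push_cast; ring_nf

lemma MulRel.sin {m : ℤ → ℂ} (hm : ∀ p, m (-p) = m p) (p : ℤ) :
    MulRel m (fun x => Complex.sin (p * x)) (fun x => m p * Complex.sin (p * x)) := by
  convert (((MulRel.exp m (-p)).add ((MulRel.exp m p).smul (-1)))).smul (Complex.I/2) using 1
  · ext x; rw [Complex.sin]; push_cast; ring_nf
  · ext x; rw [Complex.sin, hm]; push_cast; ring_nf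

lemma sum_sq_aux (b : ℕ → ℝ) (hb0 : ∀ j, 0 ≤ b j) (hb : ∀ j, b (j+1) ≤ b j) (x : ℝ) (M L : ℕ) :
    |Real.sin x * ∑ j ∈ Finset.range L, b (M + j) * Real.sin ((2 * ((M + j : ℕ) : ℝ) + 1) * x)| ≤ b M := by
  have key : ∀ j : ℕ, Real.sin x * Real.sin ((2 * (j : ℝ) + 1) * x) =
      Real.sin (((j + 1 : ℕ) : ℝ) * x) ^ 2 - Real.sin ((j : ℝ) * x) ^ 2 := by
    intro j
    have e1 : x = ((j + 1 : ℕ) : ℝ) * x - (j : ℝ) * x := by push_cast; ring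
    have e2 : (2 * (j : ℝ) + 1) * x = ((j + 1 : ℕ) : ℝ) * x + (j : ℝ) * x := by push_cast; ring
    rw [e2]
    generalize ((j + 1 : ℕ) : ℝ) * x = α at *
    generalize (j : ℝ) * x = β at *
    rw [e1, Real.sin_sub, Real.sin_add]
    have := Real.sin_sq_add_cos_sq α
    have := Real.sin_sq_add_cos_sq β
    have h1 : Real.cos α ^2 = 1 - Real.sin α ^2 := by linarith
    have h2 : Real.cos β ^2 = 1 - Real.sin β ^2 := by linarith
    ring_nf; rw [h1, h2]; ring
  set D : ℕ → ℝ := fun j => Real.sin ((j : ℝ) * x) ^ 2 with hD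
  have hD0 : ∀ j, 0 ≤ D j := fun j => sq_nonneg _
  have hD1 : ∀ j, D j ≤ 1 := fun j => Real.sin_sq_le_one _
  have main : Real.sin x * ∑ j ∈ Finset.range L, b (M + j) * Real.sin ((2 * ((M + j : ℕ) : ℝ) + 1) * x)
      ≤ b M - b (M + L) * (1 - D (M + L)) ∧ -b M + b (M + L) * D (M + L) ≤
      Real.sin x * ∑ j ∈ Finset.range L, b (M + j) * Real.sin ((2 * ((M + j : ℕ) : ℝ) + 1) * x) := by
    induction L with
    | zero =>
      simp only [Finset.range_zero, Finset.sum_empty, mul_zero, add_zero]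
      have := mul_nonneg (hb0 M) (hD0 M)
      have := mul_le_mul_of_nonneg_left (hD1 M) (hb0 M)
      constructor <;> linarith
    | succ L ih =>
      rw [Finset.sum_range_succ, mul_add]
      have e : Real.sin x * (b (M + L) * Real.sin ((2 * ((M + L : ℕ) : ℝ) + 1) * x)) =
          b (M + L) * (D (M + L + 1) - D (M + L)) := by
        rw [mul_left_comm, key]
      rw [e, ← add_assoc]
      have := mul_le_mul_of_nonneg_right (hb (M+L)) (hD0 (M+L+1))
      have := mul_le_mul_of_nonneg_right (hb (M+L)) (sub_nonneg.2 (hD1 (M+L+1)))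
      constructor <;> nlinarith [ih.1, ih.2]
  have h1 := mul_nonneg (hb0 (M+L)) (sub_nonneg.2 (hD1 (M+L)))
  have h2 := mul_nonneg (hb0 (M+L)) (hD0 (M+L))
  rw [abs_le]
  constructor <;> linarith [main.1, main.2]

lemma abs_sin_nat_mul (k : ℕ) (x : ℝ) : |Real.sin (k * x)| ≤ k * |Real.sin x| := by
  induction k with
  | zero => simp
  | succ k ih =>
    push_cast
    rw [add_mul, one_mul, Real.sin_add, add_mul, one_mul]
    refine (abs_add_le _ _).trans (add_le_add ?_ ?_)
    · rw [abs_mul]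
      exact (mul_le_of_le_one_right (abs_nonneg _) (Real.abs_cos_le_one _)).trans ih
    · rw [abs_mul]
      exact mul_le_of_le_one_left (abs_nonneg _) (Real.abs_cos_le_one _)

lemma sum_sin_bound (b : ℕ → ℝ) (hb0 : ∀ j, 0 ≤ b j) (hb : ∀ j, b (j+1) ≤ b j)
    (hb1 : ∀ j : ℕ, b j * (2 * j + 1) ≤ 1) (x : ℝ) (L : ℕ) :
    |∑ j ∈ Finset.range L, b j * Real.sin ((2 * (j : ℝ) + 1) * x)| ≤ 2 := by
  have term : ∀ j, |b j * Real.sin ((2 * (j : ℝ) + 1) * x)| ≤ |Real.sin x| := by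
    intro j
    have := abs_sin_nat_mul (2 * j + 1) x
    push_cast at this
    rw [abs_mul, abs_of_nonneg (hb0 j)]
    calc _ ≤ b j * ((2 * j + 1) * |Real.sin x|) := mul_le_mul_of_nonneg_left this (hb0 j)
      _ = (b j * (2 * j + 1)) * |Real.sin x| := by ring
      _ ≤ 1 * |Real.sin x| := mul_le_mul_of_nonneg_right (hb1 j) (abs_nonneg _)
      _ = _ := one_mul _
  have small : ∀ K : ℕ, |∑ j ∈ Finset.range K, b j * Real.sin ((2 * (j : ℝ) + 1) * x)| ≤
      K * |Real.sin x| := by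
    intro K
    refine (Finset.abs_sum_le_sum_abs _ _).trans ?_
    refine (Finset.sum_le_sum (fun j _ => term j)).trans ?_
    simp
  by_cases hs : Real.sin x = 0
  · have := small L
    rw [hs] at this; simp at this; rw [this]; simp
  have hs' : 0 < |Real.sin x| := abs_pos.2 hs
  set M := ⌊1 / |Real.sin x|⌋₊ with hM
  have hM1 : (M : ℝ) * |Real.sin x| ≤ 1 := by
    have : (M : ℝ) ≤ 1 / |Real.sin x| := Nat.floor_le (by positivity)
    rwa [le_div_iff₀ hs'] at this
  have hM2 : 1 ≤ ((M : ℝ) + 1) * |Real.sin x| := by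
    have : 1 / |Real.sin x| < M + 1 := Nat.lt_floor_add_one _
    rw [div_lt_iff₀ hs'] at this; exact this.le
  rcases le_total L M with h | h
  · refine (small L).trans ?_
    have : (L : ℝ) * |Real.sin x| ≤ M * |Real.sin x| := by gcongr
    linarith
  · obtain ⟨K, rfl⟩ := Nat.exists_eq_add_of_le h
    rw [Finset.sum_range_add]
    have h1 := small M
    have h2 := sum_sq_aux b hb0 hb x M K
    rw [abs_mul] at h2
    have h3 : |∑ j ∈ Finset.range K, b (M + j) * Real.sin ((2 * ((M + j : ℕ) : ℝ) + 1) * x)| ≤ 1 := by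
      by_contra hc
      push Not at hc
      have h4 : b M * (M + 1) ≤ 1 := by
        have := hb1 M
        have : 0 ≤ b M * M := mul_nonneg (hb0 M) (by positivity)
        nlinarith
      have h5 : |Real.sin x| < b M := by
        refine lt_of_lt_of_le ?_ h2
        nlinarith
      have h6 : (0:ℝ) < M + 1 := by positivity
      nlinarith
    refine (abs_add_le _ _).trans ?_
    linarith

def bb (c : LPCutoff) (q : ℕ) (j : ℕ) : ℝ := c.χ ((2:ℝ) ^ (-(q:ℤ)) * (2 * j + 1)) / (2 * j + 1)

lemma bb_nonneg (c : LPCutoff) (q j : ℕ) : 0 ≤ bb c q j :=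
  div_nonneg (c.nonneg _) (by positivity)

lemma bb_anti (c : LPCutoff) (q j : ℕ) : bb c q (j+1) ≤ bb c q j := by
  unfold bb
  apply div_le_div₀ (c.nonneg _) _ (by positivity)
  · push_cast; linarith
  · apply c.decay
    · simp only [Set.mem_Ici]; positivity
    · simp only [Set.mem_Ici]; positivity
    · push_cast; gcongr; linarith

lemma bb_le (c : LPCutoff) (q j : ℕ) : bb c q j * (2 * j + 1) ≤ 1 := by
  unfold bb
  rw [div_mul_cancel₀ _ (by positivity)]
  exact c.le_one _

lemma chi_zero (c : LPCutoff) {x : ℝ} (h : 4/3 ≤ |x|) : c.χ x = 0 := by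
  by_contra hc
  have := c.supp x hc
  have := abs_lt.2 this
  linarith

lemma fLow_eq (c : LPCutoff) (n q : ℕ) (hn : n = 2 * q) (x : ℝ) :
    fLow c n x = 2 / Real.pi * ∑ j ∈ Finset.range (2 ^ q), bb c q j * Real.sin ((2 * (j:ℝ) + 1) * x) := by
  have hq : ((n : ℤ) / 2) = q := by omega
  have hp := Real.pi_pos
  set g : ℤ → ℂ := fun ξ => (c.χ ((2:ℝ) ^ (-(q:ℤ)) * ξ) : ℂ) * fCoeff (toC hFun) ξ *
    Complex.exp (Complex.I * x * ξ) with hg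
  have hz : ∀ ξ : ℤ, (2:ℝ) ^ (q+1) ≤ |(ξ:ℝ)| → g ξ = 0 := by
    intro ξ h
    have : c.χ ((2:ℝ) ^ (-(q:ℤ)) * ξ) = 0 := by
      apply chi_zero
      rw [abs_mul, abs_of_pos (by positivity), zpow_neg, zpow_natCast]
      have h2 : (0:ℝ) < 2 ^ q := by positivity
      rw [inv_mul_eq_div, le_div_iff₀ h2]
      rw [pow_succ] at h
      linarith
    simp only [hg, this, Complex.ofReal_zero, zero_mul]
  have hodd : ∑' ξ : ℤ, g ξ = ∑' j : ℤ, g (2 * j + 1) := by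
    refine (Function.Injective.tsum_eq (g := fun j : ℤ => 2 * j + 1) ?_ ?_).symm
    · intro a b h; simp only at h; omega
    · intro ξ h
      rcases Int.even_or_odd ξ with h' | h'
      · exact absurd (by simp [hg, fCoeff_h_even ξ h']) h
      · obtain ⟨r, hr⟩ := h'
        exact ⟨r, hr.symm⟩
  have h1 : HasSum (fun j : ℕ => g (2 * (j:ℤ) + 1)) (∑ j ∈ Finset.range (2 ^ q), g (2 * (j:ℤ) + 1)) := by
    apply hasSum_sum_of_ne_finset_zero
    intro j hj
    apply hz
    simp only [Finset.mem_range, not_lt] at hj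
    have : ((2:ℝ) ^ q) ≤ j := by exact_mod_cast hj
    push_cast
    rw [abs_of_pos (by positivity), pow_succ]; linarith
  have h2 : HasSum (fun j : ℕ => g (2 * (-((j:ℤ) + 1)) + 1))
      (∑ j ∈ Finset.range (2 ^ q), g (2 * (-((j:ℤ) + 1)) + 1)) := by
    apply hasSum_sum_of_ne_finset_zero
    intro j hj
    apply hz
    simp only [Finset.mem_range, not_lt] at hj
    have : ((2:ℝ) ^ q) ≤ j := by exact_mod_cast hj
    push_cast
    rw [show 2 * -((j:ℝ) + 1) + 1 = - (2 * j + 1) by ring, abs_neg,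
      abs_of_pos (by positivity), pow_succ]; linarith
  have h3 := (HasSum.of_nat_of_neg_add_one (f := fun j : ℤ => g (2 * j + 1)) h1 h2).tsum_eq
  have h4 : ∀ j : ℕ, g (2 * (j:ℤ) + 1) + g (2 * (-((j:ℤ) + 1)) + 1) =
      ((4 * (bb c q j * Real.sin ((2 * (j:ℝ) + 1) * x)) : ℝ) : ℂ) := by
    intro j
    have o1 : Odd (2 * (j:ℤ) + 1) := ⟨j, rfl⟩
    have e : 2 * (-((j:ℤ) + 1)) + 1 = - (2 * (j:ℤ) + 1) := by ring
    have o2 : Odd (-(2 * (j:ℤ) + 1)) := o1.neg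
    rw [e]
    simp only [hg]
    rw [fCoeff_h_odd _ o1, fCoeff_h_odd _ o2]
    push_cast
    rw [mul_neg, c.even]
    have k0 : (2 * (j:ℂ) + 1) ≠ 0 := by exact_mod_cast (by positivity : (2 * (j:ℝ) + 1) ≠ 0)
    rw [Complex.sin]
    unfold bb
    push_cast
    field_simp
    ring_nf
  have hL : LPlow c ((n:ℤ)/2) (toC hFun) x =
      ((2 / Real.pi * ∑ j ∈ Finset.range (2 ^ q), bb c q j * Real.sin ((2 * (j:ℝ) + 1) * x) : ℝ) : ℂ) := by
    rw [hq]
    unfold LPlow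
    change _ * ∑' ξ : ℤ, g ξ = _
    rw [hodd, h3, ← Finset.sum_add_distrib, Finset.sum_congr rfl (fun j _ => h4 j)]
    rw [← Complex.ofReal_sum, ← Finset.mul_sum]
    have hpc : (Real.pi : ℂ) ≠ 0 := by exact_mod_cast hp.ne'
    rw [Complex.ofReal_mul, Complex.ofReal_mul]
    generalize ((∑ j ∈ Finset.range (2 ^ q), bb c q j * Real.sin ((2 * (j:ℝ) + 1) * x) : ℝ) : ℂ) = S
    push_cast
    field_simp
    norm_num
  rw [fLow, hL, Complex.ofReal_re]

lemma MulRel_u (m : ℤ → ℝ) (hm : ∀ p, m (-p) = m p) (N : ℤ) (A B : ℝ) (b : ℕ → ℝ) (J : ℕ) :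
    MulRel (fun ξ => (m ξ : ℂ))
      (toC fun x => A * Real.cos (N * x) *
        (1 + B * ∑ j ∈ Finset.range J, b j * Real.sin ((2 * (j:ℝ) + 1) * x)))
      (toC fun x => A * (m N * Real.cos (N * x) + B * ∑ j ∈ Finset.range J, b j / 2 *
        (m (N + (2 * j + 1)) * Real.sin ((N + (2 * j + 1) : ℤ) * x)
          - m (N - (2 * j + 1)) * Real.sin ((N - (2 * j + 1) : ℤ) * x)))) := by
  have hm' : ∀ p, (fun ξ => (m ξ : ℂ)) (-p) = (fun ξ => (m ξ : ℂ)) p := by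
    intro p; simp [hm]
  have h1 := fun j : ℕ => ((MulRel.sin (m := fun ξ => (m ξ : ℂ)) hm' (N + (2 * j + 1))).add
    ((MulRel.sin (m := fun ξ => (m ξ : ℂ)) hm' (N - (2 * j + 1))).smul (-1))).smul (b j / 2)
  have h2 := ((MulRel.cos (m := fun ξ => (m ξ : ℂ)) hm' N).add ((MulRel.sum J h1).smul B)).smul A
  convert h2 using 1
  · ext x
    simp only [toC]
    push_cast
    rw [mul_assoc, mul_add, mul_one, mul_left_comm, Finset.mul_sum]
    congr 3
    congr 1
    ext j
    rw [show ((N:ℂ) + (2 * j + 1)) * x = N * x + (2 * j + 1) * x by ring,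
      show ((N:ℂ) - (2 * j + 1)) * x = N * x - (2 * j + 1) * x by ring, Complex.sin_add,
      Complex.sin_sub]
    ring
  · ext x
    simp only [toC]
    push_cast
    congr 3
    congr 1
    ext j
    ring

lemma v_bound (m : ℤ → ℝ) (hm1 : ∀ p, |m p| ≤ 1) (Λ : ℝ) (hΛ : ∀ p r : ℤ, |m p - m r| ≤ Λ * |((p - r : ℤ) : ℝ)|)
    (N : ℤ) (A B : ℝ) (hA : 0 ≤ A) (hB0 : 0 ≤ B) (hB1 : B ≤ 1) (b : ℕ → ℝ)
    (hb0 : ∀ j, 0 ≤ b j) (hb : ∀ j, b (j+1) ≤ b j)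
    (hb1 : ∀ j : ℕ, b j * (2 * j + 1) ≤ 1) (J : ℕ) (x : ℝ) :
    |A * (m N * Real.cos (N * x) + B * ∑ j ∈ Finset.range J, b j / 2 *
        (m (N + (2 * j + 1)) * Real.sin ((N + (2 * j + 1) : ℤ) * x)
          - m (N - (2 * j + 1)) * Real.sin ((N - (2 * j + 1) : ℤ) * x)))| ≤ A * (3 + J * Λ) := by
  have hΛ0 : 0 ≤ Λ := by
    have := (abs_nonneg _).trans (hΛ 1 0)
    simpa using this
  set F := ∑ j ∈ Finset.range J, b j * Real.sin ((2 * (j:ℝ) + 1) * x) with hF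
  have hFb : |F| ≤ 2 := sum_sin_bound b hb0 hb hb1 x J
  set E := ∑ j ∈ Finset.range J, b j / 2 *
        ((m (N + (2 * j + 1)) - m N) * Real.sin ((N + (2 * j + 1) : ℤ) * x)
          - (m (N - (2 * j + 1)) - m N) * Real.sin ((N - (2 * j + 1) : ℤ) * x)) with hE
  have hEb : |E| ≤ J * Λ := by
    refine (Finset.abs_sum_le_sum_abs _ _).trans ?_
    have : ∀ j ∈ Finset.range J, |b j / 2 *
        ((m (N + (2 * j + 1)) - m N) * Real.sin ((N + (2 * j + 1) : ℤ) * x)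
          - (m (N - (2 * j + 1)) - m N) * Real.sin ((N - (2 * j + 1) : ℤ) * x))| ≤ Λ := by
      intro j _
      have k0 : (0:ℝ) < 2 * j + 1 := by positivity
      have t1 : |m (N + (2 * j + 1)) - m N| ≤ Λ * (2 * j + 1) := by
        have := hΛ (N + (2 * j + 1)) N
        rw [add_sub_cancel_left] at this
        push_cast at this
        rwa [abs_of_pos k0] at this
      have t2 : |m (N - (2 * j + 1)) - m N| ≤ Λ * (2 * j + 1) := by
        have := hΛ (N - (2 * j + 1)) N
        rw [show N - (2 * (j:ℤ) + 1) - N = -(2 * j + 1) by ring] at this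
        push_cast at this
        rwa [abs_neg, abs_of_pos k0] at this
      rw [abs_mul, abs_of_nonneg (by have := hb0 j; positivity : 0 ≤ b j / 2)]
      have t3 : |(m (N + (2 * j + 1)) - m N) * Real.sin ((N + (2 * j + 1) : ℤ) * x)
          - (m (N - (2 * j + 1)) - m N) * Real.sin ((N - (2 * j + 1) : ℤ) * x)| ≤
          Λ * (2 * j + 1) + Λ * (2 * j + 1) := by
        refine (abs_sub _ _).trans (add_le_add ?_ ?_)
        · rw [abs_mul]
          exact (mul_le_of_le_one_right (abs_nonneg _) (Real.abs_sin_le_one _)).trans t1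
        · rw [abs_mul]
          exact (mul_le_of_le_one_right (abs_nonneg _) (Real.abs_sin_le_one _)).trans t2
      calc _ ≤ b j / 2 * (Λ * (2 * j + 1) + Λ * (2 * j + 1)) :=
            mul_le_mul_of_nonneg_left t3 (by have := hb0 j; positivity)
        _ = Λ * (b j * (2 * j + 1)) := by ring
        _ ≤ Λ * 1 := mul_le_mul_of_nonneg_left (hb1 j) hΛ0
        _ = Λ := mul_one _
    refine (Finset.sum_le_sum this).trans ?_
    simp
  have hid : m N * Real.cos (N * x) + B * ∑ j ∈ Finset.range J, b j / 2 *
        (m (N + (2 * j + 1)) * Real.sin ((N + (2 * j + 1) : ℤ) * x)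
          - m (N - (2 * j + 1)) * Real.sin ((N - (2 * j + 1) : ℤ) * x)) =
      m N * Real.cos (N * x) + B * (m N * (Real.cos (N * x) * F) + E) := by
    congr 2
    rw [hF, hE, Finset.mul_sum, Finset.mul_sum, ← Finset.sum_add_distrib]
    apply Finset.sum_congr rfl
    intro j _
    push_cast
    rw [show ((N:ℝ) + (2 * j + 1)) * x = N * x + (2 * j + 1) * x by ring,
      show ((N:ℝ) - (2 * j + 1)) * x = N * x - (2 * j + 1) * x by ring, Real.sin_add,
      Real.sin_sub]
    ring
  rw [hid, abs_mul, abs_of_nonneg hA]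
  apply mul_le_mul_of_nonneg_left _ hA
  have c1 := Real.abs_cos_le_one (N * x)
  have s1 : |m N * Real.cos (N * x)| ≤ 1 := by
    rw [abs_mul]; exact mul_le_one₀ (hm1 N) (abs_nonneg _) c1
  have s2 : |m N * (Real.cos (N * x) * F)| ≤ 2 := by
    rw [← mul_assoc, abs_mul]
    exact (mul_le_of_le_one_left (abs_nonneg _) s1).trans hFb
  have s3 : |B * (m N * (Real.cos (N * x) * F) + E)| ≤ 2 + J * Λ := by
    rw [abs_mul, abs_of_nonneg hB0]
    exact (mul_le_of_le_one_left (abs_nonneg _) hB1).trans ((abs_add_le _ _).trans (add_le_add s2 hEb))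
  refine (abs_add_le _ _).trans ?_
  linarith

lemma block_eq {m : ℤ → ℂ} {u v : ℝ → ℂ} (h : MulRel m u v) (x : ℝ) :
    (1 / (2 * Real.pi)) * ∑' ξ : ℤ, m ξ * fCoeff u ξ * Complex.exp (Complex.I * x * ξ) = v x := by
  rw [(h.2 x).tsum_eq]
  have hpc : (Real.pi : ℂ) ≠ 0 := by exact_mod_cast Real.pi_pos.ne'
  field_simp

lemma phi_lip (c : LPCutoff) : ∃ L : ℝ, 0 ≤ L ∧ ∀ x y, |c.phi x - c.phi y| ≤ L * |x - y| := by
  have hs : HasCompactSupport c.χ := by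
    apply HasCompactSupport.of_support_subset_isCompact (isCompact_Icc (a := (-(4/3):ℝ)) (b := 4/3))
    intro x hx
    exact Set.Ioo_subset_Icc_self (c.supp x hx)
  obtain ⟨K, hK⟩ := ContDiff.lipschitzWith_of_hasCompactSupport hs c.smooth (by simp)
  have hl : ∀ x y, |c.χ x - c.χ y| ≤ K * |x - y| := by
    intro x y
    simpa [Real.dist_eq] using hK.dist_le_mul x y
  refine ⟨2 * K, by positivity, fun x y => ?_⟩
  have h1 := hl (x/2) (y/2)
  have h2 := hl x y
  rw [show x / 2 - y / 2 = (x - y) / 2 by ring, abs_div, abs_of_pos (by norm_num : (0:ℝ) < 2)] at h1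
  have : c.phi x - c.phi y = (c.χ (x/2) - c.χ (y/2)) - (c.χ x - c.χ y) := by
    unfold LPCutoff.phi; ring
  rw [this]
  refine (abs_sub _ _).trans ?_
  have : 0 ≤ K * |x - y| := by positivity
  linarith

lemma phi_abs (c : LPCutoff) (x : ℝ) : |c.phi x| ≤ 1 := by
  unfold LPCutoff.phi
  rw [abs_le]
  constructor <;> linarith [c.nonneg x, c.nonneg (x/2), c.le_one x, c.le_one (x/2)]

lemma phi_big (c : LPCutoff) {x : ℝ} (h : 8/3 ≤ x) : c.phi x = 0 := by
  unfold LPCutoff.phi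
  rw [chi_zero c, chi_zero c, sub_zero] <;> rw [abs_of_nonneg] <;> linarith

lemma phi_small (c : LPCutoff) {x : ℝ} (h0 : 0 ≤ x) (h : x ≤ 3/4) : c.phi x = 0 := by
  unfold LPCutoff.phi
  rw [c.eq_one, c.eq_one, sub_self] <;> constructor <;> linarith

lemma phi_even (c : LPCutoff) (x : ℝ) : c.phi (-x) = c.phi x := by
  unfold LPCutoff.phi
  rw [neg_div, c.even, c.even]
/-- `‖u_{0,n}‖_{B^1_{∞,1}(𝕋)} ≤ C n^{-2/5} log n` for all sufficiently large `n ∈ 16ℕ`. -/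
theorem u0CH_besov_bound (c : LPCutoff) :
    ∃ C : ℝ, 0 < C ∧ ∃ N : ℕ, ∀ n : ℕ, 16 ∣ n → N ≤ n →
      besov1E c (toC (u0CH c n)) ≤ ENNReal.ofReal (C * (n:ℝ) ^ (-(2:ℝ)/5) * Real.log n) := by
  obtain ⟨L, hL0, hL⟩ := phi_lip c
  refine ⟨8 * (3 + 4 * L), by positivity, 16, fun n hn16 hn => ?_⟩
  obtain ⟨t, ht⟩ := hn16
  set q := 8 * t with hq
  have hnq : n = 2 * q := by omega
  have hq8 : 8 ≤ q := by omega
  set a : ℝ := (n:ℝ) ^ (-(2:ℝ)/5) * Real.log n with ha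
  have ha0 : 0 ≤ a := mul_nonneg (Real.rpow_nonneg (by positivity) _) (Real.log_natCast_nonneg n)
  set A : ℝ := (2:ℝ) ^ (-(n:ℤ)) * a with hA
  have hA0 : 0 ≤ A := by positivity
  set B : ℝ := (n:ℝ) ^ (-(1:ℝ)/5) * (2 / Real.pi) with hB
  have hB0 : 0 ≤ B := by have := Real.pi_pos; positivity
  have hB1 : B ≤ 1 := by
    apply mul_le_one₀
    · apply Real.rpow_le_one_of_one_le_of_nonpos
      · exact_mod_cast (by omega : 1 ≤ n)
      · norm_num
    · have := Real.pi_pos; positivity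
    · rw [div_le_one Real.pi_pos]; linarith [Real.pi_gt_three]
  set N : ℤ := 2 ^ n with hN
  have hu : u0CH c n = fun x => A * Real.cos (N * x) *
        (1 + B * ∑ j ∈ Finset.range (2 ^ q), bb c q j * Real.sin ((2 * (j:ℝ) + 1) * x)) := by
    ext x
    simp only [u0CH, fLow_eq c n q hnq, hA, ha, hB, hN]
    push_cast
    ring
  have hNk : ∀ j ∈ Finset.range (2 ^ q), 2 * (2 * (j:ℤ) + 1) ≤ N := by
    intro j hj
    rw [Finset.mem_range] at hj
    have h1 : N = 2 ^ q * 2 ^ q := by rw [hN, hnq, two_mul, pow_add]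
    have h2 : (j:ℤ) + 1 ≤ 2 ^ q := by exact_mod_cast hj
    have h3 : (2:ℤ) ^ 8 ≤ 2 ^ q := pow_le_pow_right₀ (by norm_num) hq8
    rw [h1]; nlinarith
  have hNpos : 0 < N := by rw [hN]; positivity
  -- vanishing criterion
  have hvan : ∀ m : ℤ → ℝ, (∀ ξ : ℤ, N ≤ 2 * ξ → ξ ≤ 2 * N → m ξ = 0) → ∀ x : ℝ,
      A * (m N * Real.cos (N * x) + B * ∑ j ∈ Finset.range (2 ^ q), bb c q j / 2 *
        (m (N + (2 * j + 1)) * Real.sin ((N + (2 * j + 1) : ℤ) * x)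
          - m (N - (2 * j + 1)) * Real.sin ((N - (2 * j + 1) : ℤ) * x))) = 0 := by
    intro m hm x
    rw [Finset.sum_eq_zero, hm N (by linarith) (by linarith)]
    · simp
    · intro j hj
      have := hNk j hj
      rw [hm _ (by linarith) (by linarith), hm _ (by linarith) (by linarith)]
      simp
  have hNR : (N:ℝ) = 2 ^ n := by rw [hN]; push_cast; rfl
  have h0 : ∀ x, LPblock c (-1) (toC (u0CH c n)) x = 0 := by
    intro x
    have hm : ∀ p : ℤ, (fun ξ : ℤ => c.χ ξ) (-p) = (fun ξ : ℤ => c.χ ξ) p := by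
      intro p; simp [c.even]
    have := block_eq (MulRel_u (fun ξ : ℤ => c.χ ξ) hm N A B (bb c q) (2 ^ q)) x
    rw [← hu] at this
    rw [LPblock, if_pos rfl, this]
    simp only [toC]
    rw [hvan (fun ξ : ℤ => c.χ ξ), Complex.ofReal_zero]
    intro ξ h1 _
    apply chi_zero
    have h3 : (2:ℝ) ^ 16 ≤ 2 ^ n := pow_le_pow_right₀ (by norm_num) hn
    have h4 : (N:ℝ) ≤ 2 * ξ := by exact_mod_cast h1
    rw [hNR] at h4
    refine le_trans ?_ (le_abs_self _)
    norm_num at h3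
    linarith
  have hblk : ∀ (j : ℕ) (x : ℝ), LPblock c (j:ℤ) (toC (u0CH c n)) x =
      toC (fun x => A * (c.phi ((2:ℝ) ^ (-(j:ℤ)) * N) * Real.cos (N * x) +
        B * ∑ i ∈ Finset.range (2 ^ q), bb c q i / 2 *
        (c.phi ((2:ℝ) ^ (-(j:ℤ)) * (N + (2 * i + 1) : ℤ)) * Real.sin ((N + (2 * i + 1) : ℤ) * x)
          - c.phi ((2:ℝ) ^ (-(j:ℤ)) * (N - (2 * i + 1) : ℤ)) *
            Real.sin ((N - (2 * i + 1) : ℤ) * x)))) x := by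
    intro j x
    have hm : ∀ p : ℤ, (fun ξ : ℤ => c.phi ((2:ℝ) ^ (-(j:ℤ)) * ξ)) (-p) =
        (fun ξ : ℤ => c.phi ((2:ℝ) ^ (-(j:ℤ)) * ξ)) p := by
      intro p
      simp only [Int.cast_neg, mul_neg, phi_even]
    have := block_eq (MulRel_u (fun ξ : ℤ => c.phi ((2:ℝ) ^ (-(j:ℤ)) * ξ)) hm N A B (bb c q) (2 ^ q)) x
    rw [← hu] at this
    rw [LPblock, if_neg (by omega), this]
  have hz : ∀ j : ℕ, (j + 3 ≤ n ∨ n + 2 ≤ j) → ∀ x, LPblock c (j:ℤ) (toC (u0CH c n)) x = 0 := by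
    intro j hj x
    rw [hblk]
    simp only [toC]
    rw [hvan (fun ξ : ℤ => c.phi ((2:ℝ) ^ (-(j:ℤ)) * ξ)), Complex.ofReal_zero]
    intro ξ h1 h2
    have h3 : (N:ℝ) ≤ 2 * ξ := by exact_mod_cast h1
    have h4 : (ξ:ℝ) ≤ 2 * N := by exact_mod_cast h2
    rw [hNR] at h3 h4
    have hj0 : (0:ℝ) < 2 ^ j := by positivity
    have hn0 : (0:ℝ) < 2 ^ n := by positivity
    rw [zpow_neg, zpow_natCast, inv_mul_eq_div]
    rcases hj with hj | hj
    · apply phi_big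
      rw [le_div_iff₀ hj0]
      have : (2:ℝ) ^ (j + 3) ≤ 2 ^ n := pow_le_pow_right₀ (by norm_num) hj
      rw [pow_add] at this
      linarith
    · apply phi_small
      · apply div_nonneg <;> linarith
      · rw [div_le_iff₀ hj0]
        have : (2:ℝ) ^ (n + 2) ≤ 2 ^ j := pow_le_pow_right₀ (by norm_num) hj
        rw [pow_add] at this
        linarith
  have hb : ∀ j : ℕ, n ≤ j + 2 → ∀ x, ‖LPblock c (j:ℤ) (toC (u0CH c n)) x‖ ≤ A * (3 + 4 * L) := by
    intro j hj x
    rw [hblk]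
    simp only [toC]
    rw [Complex.norm_real, Real.norm_eq_abs]
    refine (v_bound (fun ξ : ℤ => c.phi ((2:ℝ) ^ (-(j:ℤ)) * ξ)) (fun p => phi_abs c _)
      (L * (2:ℝ) ^ (-(j:ℤ))) ?_ N A B hA0 hB0 hB1 (bb c q) (bb_nonneg c q) (bb_anti c q)
      (bb_le c q) (2 ^ q) x).trans ?_
    · intro p r
      refine (hL _ _).trans (le_of_eq ?_)
      rw [← mul_sub, abs_mul, abs_of_pos (by positivity : (0:ℝ) < (2:ℝ) ^ (-(j:ℤ)))]
      push_cast; ring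
    · apply mul_le_mul_of_nonneg_left _ hA0
      have : (2:ℝ) ^ q * (2:ℝ) ^ (-(j:ℤ)) ≤ 4 := by
        rw [zpow_neg, zpow_natCast, ← div_eq_mul_inv, div_le_iff₀ (by positivity)]
        have : (2:ℝ) ^ q ≤ 2 ^ (j + 2) := pow_le_pow_right₀ (by norm_num) (by omega)
        rw [pow_add] at this
        linarith
      push_cast
      nlinarith
  have hterm0 : ∀ k ∉ Finset.Icc (n - 1) (n + 2),
      (2:ℝ≥0∞) ^ ((k:ℤ) - 1) * supNormE (LPblock c ((k:ℤ) - 1) (toC (u0CH c n))) = 0 := by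
    intro k hk
    have : ∀ x, LPblock c ((k:ℤ) - 1) (toC (u0CH c n)) x = 0 := by
      rcases k with _ | j
      · simpa using h0
      · have e : (((j + 1 : ℕ) : ℤ) - 1) = j := by push_cast; ring
        rw [e]
        apply hz
        rw [Finset.mem_Icc] at hk
        omega
    simp [supNormE, this]
  have hterm : ∀ k ∈ Finset.Icc (n - 1) (n + 2),
      (2:ℝ≥0∞) ^ ((k:ℤ) - 1) * supNormE (LPblock c ((k:ℤ) - 1) (toC (u0CH c n))) ≤
        ENNReal.ofReal (2 * (3 + 4 * L) * a) := by
    intro k hk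
    rw [Finset.mem_Icc] at hk
    obtain ⟨j, rfl⟩ : ∃ j, k = j + 1 := ⟨k - 1, by omega⟩
    have e : (((j + 1 : ℕ) : ℤ) - 1) = j := by push_cast; ring
    rw [e, zpow_natCast]
    have hs : supNormE (LPblock c (j:ℤ) (toC (u0CH c n))) ≤ ENNReal.ofReal (A * (3 + 4 * L)) := by
      apply iSup_le
      intro x
      rw [← enorm_eq_nnnorm, ← ofReal_norm]
      exact ENNReal.ofReal_le_ofReal (hb j (by omega) x)
    have h2 : (2:ℝ≥0∞) ^ j ≤ ENNReal.ofReal (2 ^ (n + 1)) := by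
      rw [ENNReal.ofReal_pow (by norm_num)]
      simp only [ENNReal.ofReal_ofNat]
      exact pow_le_pow_right₀ (by norm_num) (by omega)
    refine (mul_le_mul' h2 hs).trans ?_
    rw [← ENNReal.ofReal_mul (by positivity)]
    apply ENNReal.ofReal_le_ofReal
    apply le_of_eq
    rw [hA, zpow_neg, zpow_natCast, pow_succ]
    field_simp
  unfold besov1E
  rw [tsum_eq_sum hterm0]
  refine (Finset.sum_le_sum hterm).trans ?_
  rw [Finset.sum_const, nsmul_eq_mul, Nat.card_Icc, show n + 2 + 1 - (n - 1) = 4 by omega]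
  rw [show ((4:ℕ) : ℝ≥0∞) = ENNReal.ofReal 4 by simp, ← ENNReal.ofReal_mul (by norm_num)]
  apply ENNReal.ofReal_le_ofReal
  apply le_of_eq
  rw [ha]; ring
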